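/- arXiv:1809.02353 — 2 statements merged into one kernel-verified Lean document; each statement's English description precedes it below -/
import Mathlib

section
/- Let E be a reflexive real Banach space and let {S(t)}_{t≥0} be a contraction C₀-semigroup on E such that S(t) is a compact operator for every t > 0. Let a < b, let f : [a,b] × E → E be continuous and such that for every bounded set Ω ⊆ E there exists ν_Ω ∈ L¹([a,b]) with ‖f(t,x)‖ ≤ ν_Ω(t) for a.e. t ∈ [a,b] and all x ∈ Ω. Let r > 0 and let M : C([a,b],E) → E satisfy: (m₀) M maps C([a,b], r·B̄) into r·B̄ (where B̄ is the closed unit ball of E); (m₁) whenever {xₙ} ⊂ C([a,b], r·B̄) and xₙ(t) → x(t) in E for every t ∈ (a,b] with x ∈ C([a,b],E), then M(xₙ) → M(x). Assume there exists a locally Lipschitz function V : E → ℝ with V(x) = 0 whenever ‖x‖ = r, V(x) ≤ 0 whenever ‖x‖ < r, and liminf_{h→0⁻} V(x + h·f(t,x))/h < 0 for all t ∈ (a,b] and all x with ‖x‖ = r. Then there exists a continuous function x : [a,b] → E with ‖x(t)‖ ≤ r for all t ∈ [a,b], satisfying x(t) = S(t−a)x(a) + ∫ₐᵗ S(t−s)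 f(s, x(s)) ds for all t ∈ [a,b] and the nonlocal condition x(a) = M(x). -/
open MeasureTheory Filter Topology Set

/-- The radial retraction of a normed space onto the closed ball of radius `r`. -/
noncomputable def radialRetraction {E : Type*} [NormedAddCommGroup E] [NormedSpace ℝ E]
    (r : ℝ) (x : E) : E := (r / max r ‖x‖) • x

section RadialRetraction

variable {E : Type*} [NormedAddCommGroup E] [NormedSpace ℝ E] {r : ℝ}

lemma norm_radialRetraction_le (hr : 0 < r) (x : E) : ‖radialRetraction r x‖ ≤ r := by
  have hm : 0 < max r ‖x‖ := lt_max_of_lt_left hr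
  rw [radialRetraction, norm_smul, Real.norm_of_nonneg (by positivity), div_mul_eq_mul_div,
    div_le_iff₀ hm]
  gcongr
  exact le_max_right _ _

lemma radialRetraction_of_norm_le (hr : 0 < r) {x : E} (hx : ‖x‖ ≤ r) :
    radialRetraction r x = x := by
  rw [radialRetraction, max_eq_left hx, div_self hr.ne', one_smul]

lemma norm_radialRetraction_of_le (hr : 0 < r) {x : E} (hx : r ≤ ‖x‖) :
    ‖radialRetraction r x‖ = r := by
  have hm : 0 < ‖x‖ := hr.trans_le hx
  rw [radialRetraction, max_eq_right hx, norm_smul, Real.norm_of_nonneg (by positivity),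
    div_mul_cancel₀ _ hm.ne']

lemma continuous_radialRetraction (hr : 0 < r) : Continuous (radialRetraction r : E → E) := by
  unfold radialRetraction
  refine Continuous.smul (continuous_const.div (by fun_prop) fun x => ?_) continuous_id
  exact (lt_max_of_lt_left hr).ne'

lemma lipschitzWith_radialRetraction (hr : 0 < r) :
    LipschitzWith 2 (radialRetraction r : E → E) := by
  refine LipschitzWith.of_dist_le_mul fun x y => ?_
  rw [dist_eq_norm, dist_eq_norm]
  have hx : 0 < max r ‖x‖ := lt_max_of_lt_left hr
  have hy : 0 < max r ‖y‖ := lt_max_of_lt_left hr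
  have hsplit : radialRetraction r x - radialRetraction r y
      = (r / max r ‖x‖) • (x - y) + (r / max r ‖x‖ - r / max r ‖y‖) • y := by
    simp only [radialRetraction, smul_sub, sub_smul]; abel
  have h1 : ‖(r / max r ‖x‖) • (x - y)‖ ≤ ‖x - y‖ := by
    rw [norm_smul, Real.norm_of_nonneg (by positivity)]
    refine mul_le_of_le_one_left (norm_nonneg _) ?_
    rw [div_le_one hx]
    exact le_max_left _ _
  have h2 : ‖(r / max r ‖x‖ - r / max r ‖y‖) • y‖ ≤ ‖x - y‖ := by
    have heq : r / max r ‖x‖ - r / max r ‖y‖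
        = (r / max r ‖x‖) * (max r ‖y‖ - max r ‖x‖) / max r ‖y‖ := by
      field_simp
    have habs : |max r ‖y‖ - max r ‖x‖| ≤ ‖x - y‖ := by
      refine (abs_max_sub_max_le_max r ‖y‖ r ‖x‖).trans ?_
      simp only [sub_self, abs_zero]
      refine max_le (norm_nonneg _) ?_
      rw [norm_sub_rev]
      exact abs_norm_sub_norm_le _ _
    rw [norm_smul, heq, Real.norm_eq_abs, abs_div, abs_mul, abs_of_pos (div_pos hr hx),
      abs_of_pos hy, div_mul_eq_mul_div, div_le_iff₀ hy]
    have hr1 : r / max r ‖x‖ ≤ 1 := (div_le_one hx).2 (le_max_left _ _)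
    calc r / max r ‖x‖ * |max r ‖y‖ - max r ‖x‖| * ‖y‖
        ≤ 1 * ‖x - y‖ * max r ‖y‖ := by
          gcongr
          exact le_max_right _ _
      _ = ‖x - y‖ * max r ‖y‖ := by ring
  rw [hsplit]
  calc _ ≤ ‖x - y‖ + ‖x - y‖ := (norm_add_le _ _).trans (add_le_add h1 h2)
    _ = _ := by push_cast; ring

end RadialRetraction

section Brouwer

lemma exists_polynomial_eval_eq_det {E : Type*} [NormedAddCommGroup E] [NormedSpace ℝ E]
    [FiniteDimensional ℝ E] (A : E →L[ℝ] E) :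
    ∃ p : Polynomial ℝ, p.natDegree ≤ Module.finrank ℝ E ∧
      ∀ t : ℝ, p.eval t = (ContinuousLinearMap.id ℝ E + t • A).det := by
  classical
  let b := Module.finBasis ℝ E
  let B := LinearMap.toMatrix b b (A : E →ₗ[ℝ] E)
  refine ⟨Matrix.det ((Polynomial.X : Polynomial ℝ) • B.map Polynomial.C
    + (1 : Matrix _ _ ℝ).map Polynomial.C), ?_, fun t => ?_⟩
  · simpa using Polynomial.natDegree_det_X_add_C_le B 1
  · rw [ContinuousLinearMap.det, ← LinearMap.det_toMatrix b, ← Polynomial.coe_evalRingHom,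
      RingHom.map_det]
    congr 1
    ext i j
    obtain rfl | hij := eq_or_ne i j
    · simp [B, LinearMap.toMatrix_apply, add_comm]
      ring
    · simp [B, LinearMap.toMatrix_apply, hij]
      ring

/-- An integral of `det (1 + t A(x))`, being polynomial in `t`, is constant as soon as it is
constant near `0`. -/
lemma setIntegral_det_eq_of_forall_small {E : Type*} [NormedAddCommGroup E] [NormedSpace ℝ E]
    [FiniteDimensional ℝ E] [MeasurableSpace E] [BorelSpace E] (μ : Measure E)
    [IsFiniteMeasureOnCompacts μ] {K : Set E} {s : Set E}
    (hK : IsCompact K) (hsK : s ⊆ K) (A : E → E →L[ℝ] E)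
    (hA : Continuous A) (c δ : ℝ) (hδ : 0 < δ)
    (h : ∀ t, 0 < t → t < δ → ∫ x in s, (ContinuousLinearMap.id ℝ E + t • A x).det ∂μ = c)
    (τ : ℝ) : ∫ x in s, (ContinuousLinearMap.id ℝ E + τ • A x).det ∂μ = c := by
  classical
  set N := Module.finrank ℝ E + 1 with hN
  let v : ℕ → ℝ := fun i => δ / (i + 2)
  have hv : Function.Injective v := fun i j hij => by
    have hi : (i : ℝ) + 2 ≠ 0 := by positivity
    have hj : (j : ℝ) + 2 ≠ 0 := by positivity
    simp only [v] at hij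
    rw [div_eq_div_iff hi hj] at hij
    have := mul_left_cancel₀ hδ.ne' hij
    exact_mod_cast (add_right_cancel this).symm
  have hv0 (i) : 0 < v i := by positivity
  have hv1 (i) : v i < δ := div_lt_self hδ (by have : (0:ℝ) ≤ i := by positivity
                                               linarith)
  let L : ℕ → ℝ := fun i => (Lagrange.basis (Finset.range N) v i).eval τ
  have hL : ∑ i ∈ Finset.range N, L i = 1 := by
    have := congrArg (Polynomial.eval τ)
      (Lagrange.sum_basis (v := v) (s := Finset.range N) hv.injOn ⟨0, by simp [hN]⟩)
    simpa [L, Polynomial.eval_finsetSum] using this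
  have hexp (B : E →L[ℝ] E) : (ContinuousLinearMap.id ℝ E + τ • B).det
      = ∑ i ∈ Finset.range N, (ContinuousLinearMap.id ℝ E + v i • B).det * L i := by
    obtain ⟨p, hp, hpe⟩ := exists_polynomial_eval_eq_det B
    have hdeg : p.degree < (Finset.range N).card := by
      rw [Finset.card_range]
      refine Polynomial.degree_le_natDegree.trans_lt ?_
      exact_mod_cast Nat.lt_succ_of_le hp
    have := congrArg (Polynomial.eval τ)
      (Lagrange.eq_interpolate (v := v) (s := Finset.range N) hv.injOn hdeg)
    rw [← hpe, this, Lagrange.interpolate_apply, Polynomial.eval_finsetSum]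
    simp [hpe, L]
  have hcont (t : ℝ) : Continuous fun x => (ContinuousLinearMap.id ℝ E + t • A x).det :=
    ContinuousLinearMap.continuous_det.comp (by fun_prop)
  have hint (t : ℝ) : IntegrableOn (fun x => (ContinuousLinearMap.id ℝ E + t • A x).det) s μ :=
    ((hcont t).continuousOn.integrableOn_compact hK).mono_set hsK
  simp_rw [hexp]
  rw [integral_finsetSum _ fun i _ => (hint (v i)).mul_const _]
  simp_rw [integral_mul_const, h _ (hv0 _) (hv1 _)]
  rw [← Finset.mul_sum, hL, mul_one]

lemma det_id_add_pos {E : Type*} [NormedAddCommGroup E] [NormedSpace ℝ E]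
    [FiniteDimensional ℝ E] (A : E →L[ℝ] E) (hA : ‖A‖ < 1) :
    0 < (ContinuousLinearMap.id ℝ E + A).det := by
  have : CompleteSpace E := FiniteDimensional.complete ℝ E
  have hne : ∀ t ∈ Icc (0:ℝ) 1, (ContinuousLinearMap.id ℝ E + t • A).det ≠ 0 := by
    intro t ht
    have hu : IsUnit (1 + t • A) := by
      have : ‖-(t • A)‖ < 1 := by
        rw [norm_neg, norm_smul, Real.norm_of_nonneg ht.1]
        exact (mul_le_of_le_one_left (norm_nonneg _) ht.2).trans_lt hA
      simpa using isUnit_one_sub_of_norm_lt_one this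
    have hu' : IsUnit (LinearMap.det ((1 + t • A : E →L[ℝ] E) : E →ₗ[ℝ] E)) :=
      (hu.map (ContinuousLinearMap.toLinearMapRingHom : (E →L[ℝ] E) →+* (E →ₗ[ℝ] E))).map LinearMap.det
    exact hu'.ne_zero
  have hc : ContinuousOn (fun t : ℝ => (ContinuousLinearMap.id ℝ E + t • A).det) (Icc 0 1) :=
    (ContinuousLinearMap.continuous_det.comp (by fun_prop)).continuousOn
  by_contra! hneg
  have h0 : (ContinuousLinearMap.id ℝ E + (0:ℝ) • A).det = 1 := by
    simp [ContinuousLinearMap.det]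
  obtain ⟨t, ht, hte⟩ := intermediate_value_Icc' zero_le_one hc
    (show (0:ℝ) ∈ _ by rw [h0, one_smul]; exact ⟨hneg, zero_le_one⟩)
  exact hne t ht hte


/-- There is no `C¹` retraction of a closed ball onto its boundary. -/
lemma not_exists_contDiff_retraction {E : Type*} [NormedAddCommGroup E] [InnerProductSpace ℝ E]
    [FiniteDimensional ℝ E] {R : ℝ} (hR : 0 < R) (ρ : E → E) (hρ : ContDiff ℝ 1 ρ)
    (hnorm : ∀ x, ‖x‖ ≤ R → ‖ρ x‖ = R) (hid : ∀ x, ‖x‖ = R → ρ x = x) : False := by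
  borelize E
  have : CompleteSpace E := FiniteDimensional.complete ℝ E
  have : ProperSpace E := FiniteDimensional.proper ℝ E
  let μ : Measure E := Measure.addHaar
  set k : E → E := fun x => ρ x - x with hk
  have hkc : ContDiff ℝ 1 k := hρ.sub contDiff_id
  have hkd : Differentiable ℝ k := hkc.differentiable one_ne_zero
  have hdk : Continuous (fderiv ℝ k) := hkc.continuous_fderiv one_ne_zero
  obtain ⟨C, hC⟩ := (isCompact_closedBall (0:E) R).exists_bound_of_continuousOn hdk.continuousOn
  set C' : NNReal := C.toNNReal with hC'
  have hCC : ∀ x ∈ Metric.closedBall (0:E) R, ‖fderiv ℝ k x‖₊ ≤ C' := fun x hx =>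
    NNReal.coe_le_coe.1 ((hC x hx).trans (Real.le_coe_toNNReal C))
  have hLip : LipschitzOnWith C' k (Metric.closedBall 0 R) :=
    (convex_closedBall (0:E) R).lipschitzOnWith_of_nnnorm_fderiv_le (fun x _ => hkd x) hCC
  set h : E → E := fun x => k (radialRetraction R x) with hh
  have hhL : LipschitzWith (C' * 2) h := by
    rw [← lipschitzOnWith_univ]
    exact hLip.comp (lipschitzWith_radialRetraction hR).lipschitzOnWith
      fun x _ => by simpa using norm_radialRetraction_le hR x
  have hhin : ∀ x, ‖x‖ ≤ R → h x = k x := fun x hx => by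
    simp [hh, radialRetraction_of_norm_le hR hx]
  have hhout : ∀ x, R ≤ ‖x‖ → h x = 0 := fun x hx => by
    simp [hh, hk, hid _ (norm_radialRetraction_of_le hR hx)]
  have hsmall : ∀ t : ℝ, 0 < t → t < 1 / (2 * C' + 1) →
      ∫ x in Metric.ball (0:E) R, (ContinuousLinearMap.id ℝ E + t • fderiv ℝ k x).det ∂μ
        = μ.real (Metric.ball 0 R) := by
    intro t ht0 ht1
    have hD : (0:ℝ) < 2 * C' + 1 := by positivity
    have htC : t * (2 * C') < 1 := by
      rw [lt_div_iff₀ hD] at ht1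
      linarith
    lift t to NNReal using ht0.le
    have happ : ApproximatesLinearOn (fun x => x + (t:ℝ) • h x)
        ((ContinuousLinearEquiv.refl ℝ E : E ≃L[ℝ] E) : E →L[ℝ] E) univ (t * (C' * 2)) := by
      intro x _ y _
      have hxy := hhL.dist_le_mul x y
      rw [dist_eq_norm, dist_eq_norm] at hxy
      have : x + (t:ℝ) • h x - (y + (t:ℝ) • h y)
          - ((ContinuousLinearEquiv.refl ℝ E : E ≃L[ℝ] E) : E →L[ℝ] E) (x - y)
          = (t:ℝ) • (h x - h y) := by
        simp [smul_sub]; abel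
      rw [this, norm_smul, Real.norm_of_nonneg t.coe_nonneg, NNReal.coe_mul, mul_assoc]
      gcongr
    have hc : Subsingleton E ∨ (t * (C' * 2) : NNReal)
        < ‖((ContinuousLinearEquiv.refl ℝ E).symm : E →L[ℝ] E)‖₊⁻¹ := by
      rcases subsingleton_or_nontrivial E with hs | hs
      · exact Or.inl hs
      · right
        have : ‖((ContinuousLinearEquiv.refl ℝ E).symm : E →L[ℝ] E)‖₊ = 1 := by
          ext
          simp
        rw [this, inv_one, ← NNReal.coe_lt_coe]
        push_cast
        linarith
    let H := happ.toHomeomorph _ hc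
    have hH : ∀ x, H x = x + (t:ℝ) • h x := fun x => rfl
    have himage : (fun x => x + (t:ℝ) • k x) '' Metric.ball 0 R = Metric.ball 0 R := by
      have hout : ∀ x, R ≤ ‖x‖ → H x = x := fun x hx => by simp [hH, hhout x hx]
      have h1 : (fun x => x + (t:ℝ) • k x) '' Metric.ball 0 R = H '' Metric.ball 0 R := by
        refine image_congr fun x hx => ?_
        rw [hH, hhin x (mem_ball_zero_iff.1 hx).le]
      have h2 : H '' (Metric.ball 0 R)ᶜ = (Metric.ball 0 R)ᶜ := by
        rw [image_congr (g := id), image_id]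
        intro x hx
        exact hout x (by simpa using hx)
      rw [h1, ← compl_inj_iff, ← image_compl_eq H.bijective, h2]
    have hinj : InjOn (fun x => x + (t:ℝ) • k x) (Metric.ball 0 R) := by
      intro x hx y hy hxy
      apply H.injective
      rw [hH, hH, hhin x (mem_ball_zero_iff.1 hx).le, hhin y (mem_ball_zero_iff.1 hy).le]
      exact hxy
    have hcov := integral_image_eq_integral_abs_det_fderiv_smul μ
      (f' := fun x => ContinuousLinearMap.id ℝ E + (t:ℝ) • fderiv ℝ k x)
      (s := Metric.ball 0 R) (f := fun x => x + (t:ℝ) • k x) Metric.isOpen_ball.measurableSet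
      (fun x _ => ((hasFDerivAt_id x).add
        ((hkd x).hasFDerivAt.const_smul (t:ℝ))).hasFDerivWithinAt) hinj (fun _ => (1:ℝ))
    rw [himage] at hcov
    simp only [smul_eq_mul, mul_one, setIntegral_const] at hcov
    rw [hcov]
    refine setIntegral_congr_fun Metric.isOpen_ball.measurableSet fun x hx => ?_
    refine (abs_of_pos (det_id_add_pos _ ?_)).symm
    rw [norm_smul, Real.norm_of_nonneg t.coe_nonneg]
    have := NNReal.coe_le_coe.2 (hCC x (Metric.ball_subset_closedBall hx))
    rw [coe_nnnorm] at this
    nlinarith [t.2, C'.2, mul_le_mul_of_nonneg_left this t.2]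
  have hone := setIntegral_det_eq_of_forall_small μ (isCompact_closedBall (0:E) R)
    Metric.ball_subset_closedBall (fderiv ℝ k) hdk _ _ (by positivity) hsmall 1
  have hzero : ∫ x in Metric.ball (0:E) R,
      (ContinuousLinearMap.id ℝ E + (1:ℝ) • fderiv ℝ k x).det ∂μ = 0 := by
    refine setIntegral_eq_zero_of_forall_eq_zero fun x hx => ?_
    have hρd : DifferentiableAt ℝ ρ x := hρ.differentiable one_ne_zero x
    have hder : ContinuousLinearMap.id ℝ E + (1:ℝ) • fderiv ℝ k x = fderiv ℝ ρ x := by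
      rw [hk, fderiv_fun_sub hρd differentiableAt_fun_id, fderiv_fun_id, one_smul,
        add_sub_cancel]
    rw [hder]
    by_contra hdet
    have hsurj : Function.Surjective (fderiv ℝ ρ x) := by
      exact ((Module.End.isUnit_iff _).1
        ((LinearMap.isUnit_iff_isUnit_det _).2 (isUnit_iff_ne_zero.2 hdet))).2
    have hconst : (fun y => ‖ρ y‖ ^ 2) =ᶠ[𝓝 x] fun _ => R ^ 2 := by
      filter_upwards [Metric.isOpen_ball.mem_nhds hx] with y hy
      rw [hnorm y (mem_ball_zero_iff.1 hy).le]
    have hd0 : HasFDerivAt (fun y => ‖ρ y‖ ^ 2) (0 : E →L[ℝ] ℝ) x :=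
      (hasFDerivAt_const (R ^ 2) x).congr_of_eventuallyEq hconst
    have heq := hd0.unique hρd.hasFDerivAt.norm_sq
    obtain ⟨v, hv⟩ := hsurj (ρ x)
    have := congrArg (fun L : E →L[ℝ] ℝ => L v) heq
    simp [hv, hnorm x (mem_ball_zero_iff.1 hx).le, hR.ne'] at this
  rw [hzero] at hone
  exact (measureReal_ne_zero_iff (Metric.isBounded_ball.measure_lt_top.ne)).2
    (Metric.measure_ball_pos μ 0 hR).ne' hone.symm

lemma exists_fixedPoint_of_contDiff_of_support_subset {E : Type*} [NormedAddCommGroup E]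
    [InnerProductSpace ℝ E] [FiniteDimensional ℝ E] {R : ℝ} (hR : 0 < R) (F : E → E)
    (hF : ContDiff ℝ 1 F) (hsupp : Function.support F ⊆ Metric.ball 0 R) : ∃ x, F x = x := by
  by_contra! hne
  have hG0 : ∀ x, x - F x ≠ 0 := fun x => sub_ne_zero.2 (hne x).symm
  have hG : ContDiff ℝ 1 fun x => x - F x := contDiff_id.sub hF
  refine not_exists_contDiff_retraction hR (fun x => (R / ‖x - F x‖) • (x - F x))
    ((contDiff_const.div (hG.norm ℝ hG0) fun x => norm_ne_zero_iff.2 (hG0 x)).smul hG)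
    (fun x _ => ?_) (fun x hx => ?_)
  · rw [norm_smul, norm_div, norm_norm, div_mul_cancel₀ _ (norm_ne_zero_iff.2 (hG0 x)),
      Real.norm_of_nonneg hR.le]
  · have : F x = 0 := by
      by_contra h
      exact (mem_ball_zero_iff.1 (hsupp h)).ne hx
    simp [this, hx, hR.ne']

/-- **Brouwer's fixed point theorem** for bounded continuous self-maps of a Euclidean space. -/
lemma exists_fixedPoint_of_continuous_of_bounded {E : Type*} [NormedAddCommGroup E]
    [InnerProductSpace ℝ E] [FiniteDimensional ℝ E] (F : E → E) (hF : Continuous F) (C : ℝ)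
    (hC : ∀ x, ‖F x‖ ≤ C) : ∃ x, F x = x := by
  have : ProperSpace E := FiniteDimensional.proper ℝ E
  have hC0 : 0 ≤ C := (norm_nonneg _).trans (hC 0)
  set χ : E → ℝ := fun x => max 0 (min 1 (C + 1 - ‖x‖)) with hχ
  have hχ0 : ∀ x, 0 ≤ χ x := fun x => le_max_left _ _
  have hχ1 : ∀ x, χ x ≤ 1 := fun x => max_le zero_le_one (min_le_left _ _)
  set K : E → E := fun x => χ x • F x with hK
  have hKc : Continuous K := by fun_prop
  have hsupp : Function.support K ⊆ Metric.ball 0 (C + 1) := by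
    intro x hx
    rw [mem_ball_zero_iff]
    by_contra! h
    refine hx ?_
    have : χ x = 0 := max_eq_left ((min_le_right _ _).trans (by linarith))
    simp [hK, this]
  obtain ⟨x, -, hmin⟩ := (isCompact_closedBall (0:E) (C + 1)).exists_isMinOn
    ⟨0, by simp; linarith⟩ (f := fun x => ‖x - K x‖) (by fun_prop)
  have hfix : K x = x := by
    by_contra hne
    have hpos : 0 < ‖x - K x‖ := norm_pos_iff.2 (sub_ne_zero.2 (Ne.symm hne))
    obtain ⟨G, hG, hGK, hGs⟩ := hKc.exists_contDiff_approx 1 continuous_const (fun _ => hpos)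
    obtain ⟨y, hy⟩ := exists_fixedPoint_of_contDiff_of_support_subset (by linarith) G hG
      (hGs.trans hsupp)
    have hyb : y ∈ Metric.closedBall (0:E) (C + 1) := by
      by_cases h0 : G y = 0
      · rw [← hy, h0]; simp; linarith
      · exact Metric.ball_subset_closedBall (hsupp (hGs h0))
    have h1 := hmin hyb
    have h2 := hGK y
    rw [hy, dist_eq_norm] at h2
    exact absurd h2 (not_lt.2 h1)
  refine ⟨x, ?_⟩
  have hx : ‖x‖ ≤ C := by
    rw [← hfix, hK, norm_smul, Real.norm_of_nonneg (hχ0 x)]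
    exact (mul_le_of_le_one_left (norm_nonneg _) (hχ1 x)).trans (hC x)
  have : χ x = 1 := by
    simp only [hχ]
    rw [min_eq_left (by linarith), max_eq_right zero_le_one]
  simpa [hK, this] using hfix

/-- **Schauder's fixed point theorem** for maps with relatively compact range. -/
theorem exists_fixedPoint_of_range_subset_isCompact {X : Type*} [NormedAddCommGroup X]
    [NormedSpace ℝ X] (F : X → X) (hF : Continuous F) {K : Set X} (hK : IsCompact K)
    (hFK : ∀ x, F x ∈ K) : ∃ x, F x = x := by
  have happrox : ∀ ε > 0, ∃ x, ‖x - F x‖ ≤ ε := by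
    intro ε hε
    obtain ⟨t, -, htf, hcov⟩ := hK.finite_cover_balls hε
    have : Fintype t := htf.fintype
    let w : t → X → ℝ := fun i y => max 0 (ε - ‖y - i‖)
    have hw0 : ∀ i y, 0 ≤ w i y := fun i y => le_max_left _ _
    have hwc : ∀ i, Continuous (w i) := fun i => by fun_prop
    let s : X → ℝ := fun y => ∑ i, w i y
    have hsc : Continuous s := by fun_prop
    have hspos : ∀ y ∈ K, 0 < s y := by
      intro y hy
      obtain ⟨i, hi, hyi⟩ := mem_iUnion₂.1 (hcov hy)
      refine Finset.sum_pos' (fun i _ => hw0 i y) ⟨⟨i, hi⟩, Finset.mem_univ _, ?_⟩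
      rw [mem_ball_iff_norm] at hyi
      exact lt_max_of_lt_right (by simpa using hyi)
    let p : EuclideanSpace ℝ t → X := fun a => ∑ i, a i • (i : X)
    have hpc : Continuous p := by fun_prop
    let G : EuclideanSpace ℝ t → EuclideanSpace ℝ t := fun a =>
      WithLp.toLp 2 fun i => w i (F (p a)) / s (F (p a))
    have hGc : Continuous G := by
      refine (PiLp.continuous_toLp 2 _).comp (continuous_pi fun i => ?_)
      exact ((hwc i).comp (hF.comp hpc)).div (hsc.comp (hF.comp hpc))
        fun a => (hspos _ (hFK _)).ne'
    have hG1 : ∀ a i, ‖G a i‖ ≤ 1 := by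
      intro a i
      have hs := hspos _ (hFK (p a))
      change ‖w i (F (p a)) / s (F (p a))‖ ≤ 1
      rw [Real.norm_of_nonneg (div_nonneg (hw0 _ _) hs.le), div_le_one hs]
      exact Finset.single_le_sum (fun j _ => hw0 j _) (Finset.mem_univ i)
    obtain ⟨a, ha⟩ := exists_fixedPoint_of_continuous_of_bounded G hGc
      (√(∑ _i : t, (1:ℝ) ^ 2)) fun a => by
        rw [EuclideanSpace.norm_eq]
        gcongr with i
        exact hG1 a i
    refine ⟨p a, ?_⟩
    set y := F (p a) with hy
    have hs : 0 < s y := hspos _ (hFK _)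
    have hai : ∀ i, a i = w i y / s y := fun i => by
      conv_lhs => rw [← ha]
    have hsum : ∑ i, a i = 1 := by
      simp_rw [hai, ← Finset.sum_div]
      exact div_self hs.ne'
    have hsub : p a - y = ∑ i, a i • ((i : X) - y) := by
      simp only [smul_sub, Finset.sum_sub_distrib, ← Finset.sum_smul, hsum, one_smul, p]
    rw [hsub]
    calc ‖∑ i, a i • ((i : X) - y)‖ ≤ ∑ i, a i * ε := by
          refine norm_sum_le_of_le _ fun i _ => ?_
          have hpos : 0 ≤ a i := by rw [hai]; exact div_nonneg (hw0 _ _) hs.le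
          rw [norm_smul, Real.norm_of_nonneg hpos]
          by_cases hd : ‖y - i‖ ≤ ε
          · rw [norm_sub_rev]
            gcongr
          · have : w i y = 0 := max_eq_left (by linarith)
            simp [hai, this]
      _ = ε := by rw [← Finset.sum_mul, hsum, one_mul]
  choose x hx using fun n : ℕ => happrox (1 / ((n:ℝ) + 1)) (by positivity)
  obtain ⟨z, -, φ, hφ, hz⟩ := hK.tendsto_subseq fun n => hFK (x n)
  have hdiff : Tendsto (fun n => x (φ n) - F (x (φ n))) atTop (𝓝 0) :=
    squeeze_zero_norm (fun n => hx (φ n))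
      ((tendsto_one_div_add_atTop_nhds_zero_nat (𝕜 := ℝ)).comp hφ.tendsto_atTop)
  have hxz : Tendsto (fun n => x (φ n)) atTop (𝓝 z) := by
    simpa using hdiff.add hz
  exact ⟨z, tendsto_nhds_unique ((hF.tendsto z).comp hxz) hz⟩

end Brouwer

section Duhamel

variable {E : Type*} [NormedAddCommGroup E] [NormedSpace ℝ E]

/-- A strongly continuous contraction semigroup, extended to a strongly continuous family of
contractions indexed by all of `ℝ`; the semigroup law is only required for nonnegative times. -/
structure IsContractionSemigroup (T : ℝ → E →L[ℝ] E) : Prop where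
  zero_apply : ∀ v, T 0 v = v
  add_apply : ∀ s t, 0 ≤ s → 0 ≤ t → ∀ v, T (s + t) v = T s (T t v)
  continuous_apply : ∀ v, Continuous fun t => T t v
  norm_apply_le : ∀ t v, ‖T t v‖ ≤ ‖v‖

/-- The Duhamel integral `∫ₐᵗ T(t - s) g(s) ds`. -/
noncomputable def duhamel (T : ℝ → E →L[ℝ] E) (a : ℝ) (g : ℝ → E) (t : ℝ) : E :=
  ∫ s in a..t, T (t - s) (g s)

namespace IsContractionSemigroup

variable {T : ℝ → E →L[ℝ] E} (hT : IsContractionSemigroup T) {a b : ℝ} {ν : ℝ → ℝ}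
include hT

lemma continuous_uncurry : Continuous fun p : ℝ × E => T p.1 p.2 :=
  continuous_prod_of_continuous_lipschitzWith' _ 1
    (fun t => LipschitzWith.of_dist_le_mul fun v w => by
      simpa [dist_eq_norm] using hT.norm_apply_le t (v - w))
    hT.continuous_apply

lemma continuous_integrand {g : ℝ → E} (hg : Continuous g) :
    Continuous fun p : ℝ × ℝ => T (p.1 - p.2) (g p.2) :=
  hT.continuous_uncurry.comp (f := fun p : ℝ × ℝ => (p.1 - p.2, g p.2)) (by fun_prop)

lemma intervalIntegrable {g : ℝ → E} (hg : Continuous g) (t c d : ℝ) :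
    IntervalIntegrable (fun s => T (t - s) (g s)) volume c d :=
  ((hT.continuous_integrand hg).comp (Continuous.prodMk_right t)).intervalIntegrable _ _

lemma continuous_duhamel {g : ℝ → E} (hg : Continuous g) : Continuous (duhamel T a g) :=
  intervalIntegral.continuous_parametric_intervalIntegral_of_continuous
    (f := fun t s => T (t - s) (g s)) (hT.continuous_integrand hg) continuous_id

lemma duhamel_add [CompleteSpace E] {g : ℝ → E} (hg : Continuous g) {t h : ℝ} (hat : a ≤ t)
    (hh : 0 ≤ h) :
    duhamel T a g (t + h) = T h (duhamel T a g t) + ∫ s in t..t + h, T (t + h - s) (g s) := by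
  rw [duhamel, ← intervalIntegral.integral_add_adjacent_intervals
    (hT.intervalIntegrable hg (t + h) a t) (hT.intervalIntegrable hg (t + h) t (t + h)),
    duhamel, ← ContinuousLinearMap.intervalIntegral_comp_comm _ (hT.intervalIntegrable hg t a t)]
  congr 1
  refine intervalIntegral.integral_congr fun s hs => ?_
  rw [uIcc_of_le hat] at hs
  rw [← hT.add_apply _ _ hh (sub_nonneg.2 hs.2)]
  congr 2
  ring

lemma norm_integral_le {g : ℝ → E} (hν : IntegrableOn ν (Icc a b))
    (hgν : ∀ᵐ s ∂volume.restrict (Icc a b), ‖g s‖ ≤ ν s) {c d : ℝ} (t : ℝ) (hac : a ≤ c)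
    (hcd : c ≤ d) (hdb : d ≤ b) :
    ‖∫ s in c..d, T (t - s) (g s)‖ ≤ ∫ s in c..d, ν s := by
  refine intervalIntegral.norm_integral_le_of_norm_le hcd ?_
    ((intervalIntegrable_iff_integrableOn_Icc_of_le hcd).2 (hν.mono_set (Icc_subset_Icc hac hdb)))
  filter_upwards [(ae_restrict_iff' measurableSet_Icc).1 hgν] with s hs hsc
  exact (hT.norm_apply_le _ _).trans (hs ⟨hac.trans hsc.1.le, hsc.2.trans hdb⟩)

omit hT in
lemma _root_.continuousOn_intervalIntegral (hab : a ≤ b) (hν : IntegrableOn ν (Icc a b)) :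
    ContinuousOn (fun t => ∫ s in a..t, ν s) (Icc a b) := by
  have := intervalIntegral.continuousOn_primitive_interval (μ := volume) (f := ν) (a := a)
    (b := b) (by rwa [uIcc_of_le hab])
  rwa [uIcc_of_le hab] at this

omit hT in
/-- Absolute continuity of the integral, on subintervals of a compact interval. -/
lemma _root_.exists_forall_intervalIntegral_lt (hab : a ≤ b) (hν : IntegrableOn ν (Icc a b))
    {ε : ℝ} (hε : 0 < ε) :
    ∃ δ > 0, ∀ c d, a ≤ c → c ≤ d → d ≤ b → d - c < δ → ∫ s in c..d, ν s < ε := by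
  have hc := continuousOn_intervalIntegral hab hν
  obtain ⟨δ, hδ, h⟩ := Metric.uniformContinuousOn_iff.1
    (isCompact_Icc.uniformContinuousOn_of_continuous hc) ε hε
  refine ⟨δ, hδ, fun c d hac hcd hdb hdc => ?_⟩
  have hint : ∀ x y, a ≤ x → x ≤ y → y ≤ b → IntervalIntegrable ν volume x y :=
    fun x y hx hxy hy => (intervalIntegrable_iff_integrableOn_Icc_of_le hxy).2
      (hν.mono_set (Icc_subset_Icc hx hy))
  have h1 := h d ⟨hac.trans hcd, hdb⟩ c ⟨hac, hcd.trans hdb⟩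
    (by rwa [Real.dist_eq, abs_of_nonneg (sub_nonneg.2 hcd)])
  rw [Real.dist_eq, ← intervalIntegral.integral_add_adjacent_intervals
    (hint a c le_rfl hac (hcd.trans hdb)) (hint c d hac hcd hdb), add_sub_cancel_left] at h1
  exact (le_abs_self _).trans_lt h1

/-- The values of the Duhamel integrals of all functions dominated by a fixed integrable function
form a totally bounded set. -/
lemma totallyBounded_duhamel [CompleteSpace E] (hTc : ∀ t, 0 < t → IsCompactOperator (T t))
    (hab : a ≤ b) (hν : IntegrableOn ν (Icc a b)) :
    TotallyBounded {v | ∃ g : ℝ → E, Continuous g ∧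
      (∀ᵐ s ∂volume.restrict (Icc a b), ‖g s‖ ≤ ν s) ∧ ∃ t ∈ Icc a b, v = duhamel T a g t} := by
  refine Metric.totallyBounded_iff.2 fun ε hε => ?_
  obtain ⟨δ, hδ, hsmall⟩ := exists_forall_intervalIntegral_lt hab hν (half_pos hε)
  have hc := continuousOn_intervalIntegral hab hν
  obtain ⟨R, hR⟩ := isCompact_Icc.exists_bound_of_continuousOn hc
  have hR0 : 0 ≤ R := (norm_nonneg _).trans (hR a ⟨le_rfl, hab⟩)
  set η := δ / 2 with hη
  have hη0 : 0 < η := half_pos hδ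
  have hcpt : TotallyBounded (T η '' Metric.closedBall 0 R) :=
    ((hTc η hη0).isCompact_closure_image_closedBall R).totallyBounded.subset subset_closure
  obtain ⟨F, hF, hcov⟩ := Metric.totallyBounded_iff.1 hcpt (ε / 2) (half_pos hε)
  refine ⟨F, hF, ?_⟩
  have key : ∀ v, ∀ w ∈ T η '' Metric.closedBall 0 R, ‖v - w‖ < ε / 2 →
      v ∈ ⋃ y ∈ F, Metric.ball y ε := by
    intro v w hw hvw
    obtain ⟨y, hy, hwy⟩ := mem_iUnion₂.1 (hcov hw)
    refine mem_iUnion₂.2 ⟨y, hy, ?_⟩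
    rw [Metric.mem_ball] at hwy ⊢
    rw [← dist_eq_norm] at hvw
    linarith [dist_triangle v w y]
  rintro v ⟨g, hg, hgν, t, ht, rfl⟩
  rcases le_total (t - η) a with hta | hta
  · refine key _ 0 ⟨0, by simpa using hR0, by simp⟩ ?_
    rw [sub_zero]
    exact (hT.norm_integral_le hν hgν t le_rfl ht.1 ht.2).trans_lt
      (hsmall a t le_rfl ht.1 ht.2 (by linarith))
  · have hadd := hT.duhamel_add hg hta hη0.le
    rw [sub_add_cancel] at hadd
    refine key _ _ ⟨duhamel T a g (t - η), ?_, rfl⟩ ?_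
    · rw [mem_closedBall_zero_iff]
      have ht' : t - η ≤ b := by linarith [ht.2]
      exact (hT.norm_integral_le hν hgν (t - η) le_rfl hta ht').trans
        ((le_abs_self _).trans (hR (t - η) ⟨hta, ht'⟩))
    · rw [hadd, add_sub_cancel_left]
      exact (hT.norm_integral_le hν hgν t hta (by linarith) ht.2).trans_lt
        (hsmall _ _ hta (by linarith) ht.2 (by linarith))

lemma eventually_norm_sub_lt_of_isCompact {K : Set E} (hK : IsCompact K) {ε : ℝ} (hε : 0 < ε) :
    ∀ᶠ h in 𝓝 (0:ℝ), ∀ v ∈ K, ‖T h v - v‖ < ε := by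
  refine hK.eventually_forall_of_forall_eventually fun v _ => ?_
  have hc : Continuous fun p : ℝ × E => ‖T p.1 p.2 - p.2‖ :=
    (hT.continuous_uncurry.sub continuous_snd).norm
  exact hc.continuousAt.eventually_lt continuousAt_const (by simpa [hT.zero_apply] using hε)

omit hT in
lemma _root_.ContinuousMap.exists_isCompact_of_equicontinuous {α β : Type*} [TopologicalSpace α]
    [CompactSpace α] [MetricSpace β] {s : Set β} (hs : IsCompact s) (A : Set C(α, β))
    (hA : ∀ q ∈ A, ∀ x, q x ∈ s) (heq : Equicontinuous ((↑) : A → α → β)) :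
    ∃ K, IsCompact K ∧ A ⊆ K := by
  let e := ContinuousMap.isometryEquivBoundedOfCompact α β
  have hc := BoundedContinuousFunction.arzela_ascoli s hs (e '' A)
    (by rintro _ x ⟨q, hq, rfl⟩; exact hA q hq x) (by
      intro x U hU
      filter_upwards [heq x U hU] with y hy
      rintro ⟨_, q, hq, rfl⟩
      exact hy ⟨q, hq⟩)
  refine ⟨_, hc.image e.symm.continuous, fun q hq => ⟨e q, subset_closure ⟨q, hq, rfl⟩, ?_⟩⟩
  exact e.symm_apply_apply q

/-- The Duhamel integrals of all functions dominated by a fixed integrable function lie in a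
compact set of continuous functions. -/
lemma exists_isCompact_duhamel [CompleteSpace E] (hTc : ∀ t, 0 < t → IsCompactOperator (T t))
    (hab : a ≤ b) (hν : IntegrableOn ν (Icc a b)) :
    ∃ K : Set C(Icc a b, E), IsCompact K ∧ ∀ (q : C(Icc a b, E)) (g : ℝ → E), Continuous g →
      (∀ᵐ s ∂volume.restrict (Icc a b), ‖g s‖ ≤ ν s) → (∀ t, q t = duhamel T a g t) → q ∈ K := by
  have htb := hT.totallyBounded_duhamel hTc hab hν
  set Z := {v | ∃ g : ℝ → E, Continuous g ∧
      (∀ᵐ s ∂volume.restrict (Icc a b), ‖g s‖ ≤ ν s) ∧ ∃ t ∈ Icc a b, v = duhamel T a g t}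
  have hZ : IsCompact (closure Z) := htb.closure.isCompact_of_isClosed isClosed_closure
  set A : Set C(Icc a b, E) := {q | ∃ g : ℝ → E, Continuous g ∧
      (∀ᵐ s ∂volume.restrict (Icc a b), ‖g s‖ ≤ ν s) ∧ ∀ t, q t = duhamel T a g t}
  obtain ⟨K, hK, hAK⟩ := ContinuousMap.exists_isCompact_of_equicontinuous hZ A
    (by
      rintro q ⟨g, hg, hgν, hq⟩ t
      exact subset_closure ⟨g, hg, hgν, t, t.2, hq t⟩)
    (by
      refine UniformEquicontinuous.equicontinuous (Metric.uniformEquicontinuous_iff.2 ?_)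
      intro ε hε
      obtain ⟨δ₁, hδ₁, hsmall⟩ := exists_forall_intervalIntegral_lt hab hν (half_pos hε)
      obtain ⟨δ₂, hδ₂, hunif⟩ := Metric.eventually_nhds_iff.1
        (hT.eventually_norm_sub_lt_of_isCompact hZ (half_pos hε))
      have key : ∀ x y : Icc a b, (x : ℝ) ≤ y → dist x y < min δ₁ δ₂ →
          ∀ q : A, dist ((q : C(Icc a b, E)) x) ((q : C(Icc a b, E)) y) < ε := by
        rintro x y hxy hd ⟨q, g, hg, hgν, hq⟩
        rw [Subtype.dist_eq, Real.dist_eq, abs_sub_comm, abs_of_nonneg (sub_nonneg.2 hxy),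
          lt_min_iff] at hd
        have hadd := hT.duhamel_add hg x.2.1 (sub_nonneg.2 hxy)
        rw [add_sub_cancel] at hadd
        have h1 := hunif (y := (y:ℝ) - x)
          (by rw [Real.dist_eq, sub_zero, abs_of_nonneg (sub_nonneg.2 hxy)]; exact hd.2)
          (duhamel T a g x) (subset_closure ⟨g, hg, hgν, x, x.2, rfl⟩)
        have h2 := (hT.norm_integral_le hν hgν y x.2.1 hxy y.2.2).trans_lt
          (hsmall x y x.2.1 hxy y.2.2 hd.1)
        rw [dist_comm, dist_eq_norm]
        change ‖q y - q x‖ < ε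
        rw [hq, hq, hadd, add_sub_right_comm]
        exact (norm_add_le _ _).trans_lt (by linarith)
      refine ⟨min δ₁ δ₂, lt_min hδ₁ hδ₂, fun x y hd q => ?_⟩
      rcases le_total (x:ℝ) y with hxy | hxy
      · exact key x y hxy hd q
      · rw [dist_comm]
        exact key y x hxy (by rwa [dist_comm]) q)
  exact ⟨K, hK, fun q g hg hgν hq => hAK ⟨g, hg, hgν, hq⟩⟩

/-- The Duhamel integral depends continuously on the inhomogeneity, under domination. -/
lemma exists_tendsto_forall_norm_duhamel_sub_le {ι : Type*} {l : Filter ι}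
    [l.IsCountablyGenerated] (hab : a ≤ b) (hν : IntegrableOn ν (Icc a b)) {g : ι → ℝ → E}
    {g₀ : ℝ → E} (hg : ∀ i, Continuous (g i)) (hg₀ : Continuous g₀)
    (hgν : ∀ i, ∀ᵐ s ∂volume.restrict (Icc a b), ‖g i s‖ ≤ ν s)
    (hlim : ∀ s ∈ Ioc a b, Tendsto (fun i => g i s) l (𝓝 (g₀ s))) :
    ∃ e : ι → ℝ, Tendsto e l (𝓝 0) ∧
      ∀ i, ∀ t ∈ Icc a b, ‖duhamel T a (g i) t - duhamel T a g₀ t‖ ≤ e i := by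
  refine ⟨fun i => ∫ s in a..b, ‖g i s - g₀ s‖, ?_, fun i t ht => ?_⟩
  · have h := intervalIntegral.tendsto_integral_filter_of_dominated_convergence (μ := volume)
      (a := a) (b := b) (l := l) (F := fun i s => ‖g i s - g₀ s‖) (f := fun _ => (0:ℝ))
      (fun s => ν s + ‖g₀ s‖)
      (Eventually.of_forall fun i => ((hg i).sub hg₀).norm.aestronglyMeasurable)
      (Eventually.of_forall fun i => ?_) ?_ ?_
    · simpa using h
    · filter_upwards [(ae_restrict_iff' measurableSet_Icc).1 (hgν i)] with s hs hsab
      rw [uIoc_of_le hab] at hsab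
      rw [norm_norm]
      exact (norm_sub_le _ _).trans (by gcongr; exact hs (Ioc_subset_Icc_self hsab))
    · exact ((intervalIntegrable_iff_integrableOn_Icc_of_le hab).2 hν).add
        (hg₀.norm.intervalIntegrable _ _)
    · refine Eventually.of_forall fun s hs => ?_
      rw [uIoc_of_le hab] at hs
      simpa using ((hlim s hs).sub_const (g₀ s)).norm
  · have hi : Continuous fun s => ‖g i s - g₀ s‖ := ((hg i).sub hg₀).norm
    rw [duhamel, duhamel, ← intervalIntegral.integral_sub (hT.intervalIntegrable (hg i) _ _ _)
      (hT.intervalIntegrable hg₀ _ _ _)]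
    calc _ ≤ ∫ s in a..t, ‖g i s - g₀ s‖ := by
          refine intervalIntegral.norm_integral_le_of_norm_le ht.1
            (Eventually.of_forall fun s _ => ?_) (hi.intervalIntegrable _ _)
          rw [← map_sub]
          exact hT.norm_apply_le _ _
      _ ≤ _ := intervalIntegral.integral_mono_interval le_rfl ht.1 ht.2
          (Eventually.of_forall fun s => norm_nonneg _) (hi.intervalIntegrable _ _)

end IsContractionSemigroup

end Duhamel

section Bounding

variable {E : Type*} [NormedAddCommGroup E] [NormedSpace ℝ E]

/-- A locally Lipschitz function that is nonpositive on a ball, vanishes on its boundary and has a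
negative lower left derivative along `u` at a boundary point witnesses that the backward ray from
this point leaves the ball at positive speed. -/
lemma exists_frequently_le_norm_sub_smul_of_liminf_neg {V : E → ℝ} (hV : LocallyLipschitz V)
    {r : ℝ} (hr : 0 < r) (hV0 : ∀ x, ‖x‖ = r → V x = 0) (hVle : ∀ x, ‖x‖ < r → V x ≤ 0)
    {x u : E} (hx : ‖x‖ = r) (hlim : liminf (fun h : ℝ => V (x + h • u) / h) (𝓝[<] 0) < 0) :
    ∃ c > 0, ∃ᶠ h in 𝓝[>] (0:ℝ), r + c * h ≤ ‖x - h • u‖ := by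
  obtain ⟨L, U, hU, hLU⟩ := hV x
  obtain ⟨ρ, hρ, hρU⟩ := Metric.mem_nhds_iff.1 hU
  have hnear : ∀ᶠ h in 𝓝[<] (0:ℝ), x + h • u ∈ Metric.ball x (ρ / 2) := by
    have hc : Tendsto (fun h : ℝ => x + h • u) (𝓝[<] 0) (𝓝 x) := by
      have : Continuous fun h : ℝ => x + h • u := by fun_prop
      simpa using (this.tendsto 0).mono_left nhdsWithin_le_nhds
    exact hc (Metric.ball_mem_nhds x (half_pos hρ))
  have hLip : ∀ y ∈ Metric.ball x ρ, ∀ z ∈ Metric.ball x ρ, V y - V z ≤ L * ‖y - z‖ := by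
    intro y hy z hz
    have h := hLU.dist_le_mul y (hρU hy) z (hρU hz)
    rw [Real.dist_eq, dist_eq_norm] at h
    exact (le_abs_self _).trans h
  have hsub : Metric.ball x (ρ / 2) ⊆ Metric.ball x ρ := Metric.ball_subset_ball (by linarith)
  have hbdd : ∀ᶠ h in 𝓝[<] (0:ℝ), V (x + h • u) / h ≤ L * ‖u‖ := by
    filter_upwards [hnear, self_mem_nhdsWithin] with h hh hneg
    have h1 := hLip x (Metric.mem_ball_self hρ) _ (hsub hh)
    rw [hV0 x hx, sub_add_cancel_left, norm_neg, norm_smul, Real.norm_eq_abs,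
      abs_of_neg hneg] at h1
    rw [div_le_iff_of_neg hneg]
    linarith
  obtain ⟨c, hc1, hc2⟩ := exists_between hlim
  have hfreq := frequently_lt_of_liminf_lt
    (IsBoundedUnder.isCoboundedUnder_ge ⟨_, eventually_map.2 hbdd⟩) hc1
  have hL : (0:ℝ) < L + 1 := by positivity
  refine ⟨-c / (L + 1), div_pos (neg_pos.2 hc2) hL, ?_⟩
  have hmap : Tendsto (fun h : ℝ => -h) (𝓝[<] 0) (𝓝[>] 0) := by
    simpa using tendsto_neg_nhdsLT (a := (0:ℝ))
  refine hmap.frequently ((hfreq.and_eventually (hnear.and self_mem_nhdsWithin)).mono ?_)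
  rintro h ⟨hlt, hh, hneg⟩
  rw [neg_smul, sub_neg_eq_add]
  rw [div_lt_iff_of_neg hneg] at hlt
  set y := x + h • u
  have hpos : 0 < c * h := mul_pos_of_neg_of_neg hc2 hneg
  have hyr : r < ‖y‖ := by
    by_contra! hle
    rcases hle.lt_or_eq with hl | hl
    · linarith [hVle y hl]
    · linarith [hV0 y hl]
  have hy0 : 0 < ‖y‖ := hr.trans hyr
  set z := (r / ‖y‖) • y
  have hz : ‖z‖ = r := by
    rw [norm_smul, Real.norm_eq_abs, abs_of_pos (div_pos hr hy0), div_mul_cancel₀ _ hy0.ne']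
  have hyz : ‖y - z‖ = ‖y‖ - r := by
    have : y - z = (1 - r / ‖y‖) • y := by rw [sub_smul, one_smul]
    rw [this, norm_smul, Real.norm_eq_abs, abs_of_nonneg
      (sub_nonneg.2 ((div_le_one hy0).2 hyr.le)), sub_mul, div_mul_cancel₀ _ hy0.ne', one_mul]
  rw [mem_ball_iff_norm] at hh
  have hyx : ‖y‖ - r ≤ ‖y - x‖ := by rw [← hx]; exact norm_sub_norm_le _ _
  have hzx : z ∈ Metric.ball x ρ := by
    rw [mem_ball_iff_norm]
    have := norm_sub_le_norm_sub_add_norm_sub z y x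
    rw [norm_sub_rev z y] at this
    linarith
  have h1 := hLip y (hsub (mem_ball_iff_norm.2 hh)) z hzx
  rw [hV0 z hz, hyz] at h1
  have h2 : -c / (L + 1) * -h ≤ ‖y‖ - r := by
    rw [div_mul_eq_mul_div, div_le_iff₀ hL]
    nlinarith
  linarith

end Bounding

section WeakLimit

variable {E : Type*} [NormedAddCommGroup E] [NormedSpace ℝ E]

/-- In a reflexive space, bounded sequences have subsequences converging strongly after applying
the operators of a compact contraction semigroup at positive times. -/
lemma IsContractionSemigroup.exists_strictMono_tendsto {T : ℝ → E →L[ℝ] E}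
    (hT : IsContractionSemigroup T)
    (hrefl : Function.Surjective (NormedSpace.inclusionInDoubleDual ℝ E))
    (hTc : ∀ t, 0 < t → IsCompactOperator (T t)) {r : ℝ} (v : ℕ → E) (hv : ∀ n, ‖v n‖ ≤ r) :
    ∃ x₀, ‖x₀‖ ≤ r ∧ ∃ φ : ℕ → ℕ, StrictMono φ ∧
      ∀ t, 0 < t → Tendsto (fun n => T t (v (φ n))) atTop (𝓝 (T t x₀)) := by
  let 𝒰 : Ultrafilter ℕ := hyperfilter ℕ
  have hr : 0 ≤ r := (norm_nonneg _).trans (hv 0)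
  let J : E → WeakDual ℝ (StrongDual ℝ E) :=
    fun w => StrongDual.toWeakDual (NormedSpace.inclusionInDoubleDual ℝ E w)
  obtain ⟨ξ, -, hξlim⟩ := (WeakDual.isCompact_closedBall (𝕜 := ℝ) (E := StrongDual ℝ E) 0
    r).ultrafilter_le_nhds (𝒰.map fun n => J (v n)) (by
      rw [Ultrafilter.coe_map, le_principal_iff, mem_map]
      refine univ_mem' fun n => ?_
      simp only [mem_preimage, mem_closedBall_zero_iff, J]
      exact (NormedSpace.double_dual_bound ℝ E (v n)).trans (hv n))
  obtain ⟨x₀, hx₀⟩ := hrefl (WeakDual.toStrongDual ξ)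
  have hweak : ∀ ℓ : StrongDual ℝ E, Tendsto (fun n => ℓ (v n)) 𝒰 (𝓝 (ℓ x₀)) := by
    intro ℓ
    have h1 : Tendsto (fun n => J (v n)) 𝒰 (𝓝 ξ) := hξlim
    have h2 := ((WeakDual.eval_continuous ℓ).tendsto ξ).comp h1
    have h3 : ξ ℓ = ℓ x₀ := by
      have := congrArg (fun F : StrongDual ℝ (StrongDual ℝ E) => F ℓ) hx₀
      simpa using this.symm
    rw [h3] at h2
    exact h2
  have hx₀r : ‖x₀‖ ≤ r := by
    refine NormedSpace.norm_le_dual_bound ℝ x₀ hr fun ℓ => ?_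
    refine le_of_tendsto (hweak ℓ).norm (Eventually.of_forall fun n => ?_)
    rw [mul_comm]
    exact ℓ.le_opNorm_of_le (hv n)
  have hstrong : ∀ t, 0 < t → Tendsto (fun n => T t (v n)) 𝒰 (𝓝 (T t x₀)) := by
    intro t ht
    obtain ⟨y, -, hy⟩ := ((hTc t ht).isCompact_closure_image_closedBall r).ultrafilter_le_nhds
      (𝒰.map fun n => T t (v n)) (by
        rw [Ultrafilter.coe_map, le_principal_iff, mem_map]
        exact univ_mem' fun n => subset_closure ⟨v n, by simpa using hv n, rfl⟩)
    have hy' : Tendsto (fun n => T t (v n)) 𝒰 (𝓝 y) := hy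
    have : y = T t x₀ := by
      refine (SeparatingDual.eq_iff_forall_dual_eq (R := ℝ)).2 fun ℓ => ?_
      exact tendsto_nhds_unique ((ℓ.continuous.tendsto y).comp hy') (hweak (ℓ.comp (T t)))
    rwa [this] at hy'
  have hfreq : ∀ k : ℕ, ∃ᶠ n in atTop,
      ‖T (1 / ((k:ℝ) + 1)) (v n) - T (1 / ((k:ℝ) + 1)) x₀‖ < 1 / ((k:ℝ) + 1) := by
    intro k
    have hk : (0:ℝ) < 1 / ((k:ℝ) + 1) := Nat.one_div_pos_of_nat
    have h1 : ∀ᶠ n in (𝒰 : Filter ℕ),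
        ‖T (1 / ((k:ℝ) + 1)) (v n) - T (1 / ((k:ℝ) + 1)) x₀‖ < 1 / ((k:ℝ) + 1) := by
      filter_upwards [Metric.tendsto_nhds.1 (hstrong _ hk) _ hk] with n hn
      rwa [← dist_eq_norm]
    exact h1.frequently.filter_mono (Nat.hyperfilter_le_atTop)
  obtain ⟨φ, hφ, hφT⟩ := extraction_forall_of_frequently hfreq
  refine ⟨x₀, hx₀r, φ, hφ, fun t ht => ?_⟩
  rw [tendsto_iff_norm_sub_tendsto_zero]
  refine squeeze_zero' (Eventually.of_forall fun n => norm_nonneg _) ?_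
    tendsto_one_div_add_atTop_nhds_zero_nat
  filter_upwards [(tendsto_one_div_add_atTop_nhds_zero_nat (𝕜 := ℝ)).eventually_le_const ht]
    with n hn
  have hk : (0:ℝ) < 1 / ((n:ℝ) + 1) := Nat.one_div_pos_of_nat
  have h1 : ∀ w, T t w = T (t - 1 / ((n:ℝ) + 1)) (T (1 / ((n:ℝ) + 1)) w) := fun w => by
    rw [← hT.add_apply _ _ (sub_nonneg.2 hn) hk.le, sub_add_cancel]
  rw [h1, h1 x₀, ← map_sub]
  exact (hT.norm_apply_le _ _).trans (hφT n).le

end WeakLimit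

section Approximation

variable {E : Type*} [NormedAddCommGroup E] [NormedSpace ℝ E] [CompleteSpace E]

namespace IsContractionSemigroup

variable {T : ℝ → E →L[ℝ] E} (hT : IsContractionSemigroup T) {a b r : ℝ} {ν : ℝ → ℝ}
include hT

/-- A mild solution starting inside a ball cannot touch the boundary of the ball for the first time
at a point from which the backward ray along the inhomogeneity leaves the ball. -/
lemma norm_add_duhamel_lt {g : ℝ → E} (hg : Continuous g) {v : E} (hv : ‖v‖ < r)
    (hout : ∀ t ∈ Ioc a b, ‖T (t - a) v + duhamel T a g t‖ = r →
      (∀ s ∈ Icc a t, ‖T (s - a) v + duhamel T a g s‖ ≤ r) →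
      ∃ c > 0, ∃ᶠ h in 𝓝[>] (0:ℝ), r + c * h ≤ ‖T (t - a) v + duhamel T a g t - h • g t‖) :
    ∀ t ∈ Icc a b, ‖T (t - a) v + duhamel T a g t‖ < r := by
  set x : ℝ → E := fun t => T (t - a) v + duhamel T a g t with hx
  have hxc : Continuous x :=
    ((hT.continuous_apply v).comp (continuous_id.sub continuous_const)).add
      (hT.continuous_duhamel hg)
  have hxa : x a = v := by simp [hx, duhamel, hT.zero_apply]
  by_contra! hcon
  obtain ⟨t₁, ht₁, hrt₁⟩ := hcon
  have hcpt : IsCompact (Icc a b ∩ {t | r ≤ ‖x t‖}) :=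
    isCompact_Icc.inter_right (isClosed_le continuous_const hxc.norm)
  obtain ⟨t₀, ⟨ht₀, hrt₀⟩, hmin⟩ := hcpt.exists_isLeast ⟨t₁, ht₁, hrt₁⟩
  have hlt : ∀ s, a ≤ s → s < t₀ → ‖x s‖ < r := fun s has hs => by
    by_contra! h
    exact hs.not_ge (hmin ⟨⟨has, hs.le.trans ht₀.2⟩, h⟩)
  have hat : a < t₀ := ht₀.1.lt_of_ne fun h => by
    rw [mem_ofPred_eq, ← h, hxa] at hrt₀
    exact hv.not_ge hrt₀
  have hle : ‖x t₀‖ ≤ r := by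
    refine le_of_tendsto ((hxc.norm.tendsto t₀).mono_left (nhdsWithin_le_nhds (s := Iio t₀))) ?_
    filter_upwards [Ioo_mem_nhdsLT hat] with s hs using (hlt s hs.1.le hs.2).le
  obtain ⟨c, hc, hfreq⟩ := hout t₀ ⟨hat, ht₀.2⟩ (hle.antisymm hrt₀) fun s hs =>
    hs.2.lt_or_eq.elim (fun h => (hlt s hs.1 h).le) (fun h => h ▸ hle)
  have hcont : Continuous fun s => ‖T (t₀ - s) (g s) - g t₀‖ :=
    (((hT.continuous_integrand hg).comp (Continuous.prodMk_right t₀)).sub continuous_const).norm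
  obtain ⟨δ, hδ, hclose⟩ := Metric.eventually_nhds_iff.1
    (hcont.continuousAt.eventually_lt (continuousAt_const (x := t₀) (y := c))
      (by simpa [hT.zero_apply] using hc))
  refine hfreq ?_
  filter_upwards [Ioo_mem_nhdsGT (lt_min hδ (sub_pos.2 hat))] with h hh
  obtain ⟨hh0, hhδ, hha⟩ : 0 < h ∧ h < δ ∧ h < t₀ - a := ⟨hh.1, lt_min_iff.1 hh.2⟩
  have hadd := hT.duhamel_add hg (a := a) (t := t₀ - h) (by linarith) hh0.le
  rw [sub_add_cancel] at hadd
  have hstep : x t₀ = T h (x (t₀ - h)) + ∫ s in t₀ - h..t₀, T (t₀ - s) (g s) := by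
    simp only [hx]
    rw [hadd, map_add, ← hT.add_apply _ _ hh0.le (by linarith), add_assoc]
    congr 3
    ring
  have hint : ‖(∫ s in t₀ - h..t₀, T (t₀ - s) (g s)) - h • g t₀‖ ≤ c * h := by
    have h1 : h • g t₀ = ∫ _ in t₀ - h..t₀, g t₀ := by simp
    rw [h1, ← intervalIntegral.integral_sub (hT.intervalIntegrable hg _ _ _)
      intervalIntegrable_const]
    have h2 := intervalIntegral.norm_integral_le_of_norm_le_const (a := t₀ - h) (b := t₀) (C := c)
      (f := fun s => T (t₀ - s) (g s) - g t₀) (fun s hs => by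
        rw [uIoc_of_le (by linarith)] at hs
        refine (hclose ?_).le
        rw [Real.dist_eq, abs_lt]
        constructor <;> linarith [hs.1, hs.2])
    rwa [sub_sub_cancel, abs_of_pos hh0] at h2
  rw [not_le]
  change ‖x t₀ - h • g t₀‖ < _
  rw [hstep, add_sub_assoc]
  have h3 := (hT.norm_apply_le h (x (t₀ - h))).trans_lt (hlt (t₀ - h) (by linarith) (by linarith))
  exact (norm_add_le _ _).trans_lt (add_lt_add_of_lt_of_le h3 hint)

/-- Solvability of the nonlocal problem when the initial operator is continuous, has relatively
compact range and maps into the open ball. -/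
lemma exists_nonlocal_solution_of_compact (hTc : ∀ t, 0 < t → IsCompactOperator (T t))
    (hab : a ≤ b) (hν : IntegrableOn ν (Icc a b)) {f : ℝ → E → E}
    (hf : Continuous fun p : ℝ × E => f p.1 p.2) (hr : 0 < r)
    (hfν : ∀ᵐ s ∂volume.restrict (Icc a b), ∀ x, ‖x‖ ≤ r → ‖f s x‖ ≤ ν s)
    (hout : ∀ t ∈ Ioc a b, ∀ x, ‖x‖ = r →
      ∃ c > 0, ∃ᶠ h in 𝓝[>] (0:ℝ), r + c * h ≤ ‖x - h • f t x‖)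
    {N : C(Icc a b, E) → E} (hN : Continuous N) {K : Set E} (hK : IsCompact K)
    (hNK : ∀ q, N q ∈ K) (hNr : ∀ q, ‖N q‖ < r) :
    ∃ q : C(Icc a b, E), (∀ t, ‖q t‖ ≤ r) ∧ ∀ t : Icc a b,
      q t = T (t - a) (N q) + duhamel T a (fun s => f s (q (projIcc a b hab s))) t := by
  let g : C(Icc a b, E) → ℝ → E := fun q s => f s (radialRetraction r (q (projIcc a b hab s)))
  have hg : ∀ q, Continuous (g q) := fun q =>
    hf.comp (f := fun s => (s, radialRetraction r (q (projIcc a b hab s))))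
      (continuous_id.prodMk ((continuous_radialRetraction hr).comp
        (q.continuous.comp continuous_projIcc)))
  have hgν : ∀ q, ∀ᵐ s ∂volume.restrict (Icc a b), ‖g q s‖ ≤ ν s := fun q => by
    filter_upwards [hfν] with s hs using hs _ (norm_radialRetraction_le hr _)
  let L : E → C(Icc a b, E) := ContinuousMap.curry
    ⟨fun p : E × Icc a b => T (p.2 - a) p.1, hT.continuous_uncurry.comp
      (f := fun p : E × Icc a b => ((p.2:ℝ) - a, p.1)) (by fun_prop)⟩
  have hL : Continuous L := ContinuousMap.continuous _
  let D : C(Icc a b, E) → C(Icc a b, E) := fun q =>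
    ⟨fun t => duhamel T a (g q) t, (hT.continuous_duhamel (hg q)).comp continuous_subtype_val⟩
  have hD : Continuous D := by
    refine continuous_iff_continuousAt.2 fun q₀ => ?_
    obtain ⟨e, he, hbound⟩ := hT.exists_tendsto_forall_norm_duhamel_sub_le (l := 𝓝 q₀) hab hν hg
      (hg q₀) hgν fun s _ => by
        have : Continuous fun q => g q s :=
          hf.comp (f := fun q : C(Icc a b, E) => (s, radialRetraction r (q (projIcc a b hab s))))
            (continuous_const.prodMk ((continuous_radialRetraction hr).comp
              (continuous_eval_const _)))
        exact this.tendsto q₀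
    refine tendsto_iff_norm_sub_tendsto_zero.2 (squeeze_zero (fun q => norm_nonneg _) ?_ he)
    intro q
    exact (ContinuousMap.norm_le _ ((norm_nonneg _).trans (hbound q a ⟨le_rfl, hab⟩))).2
      fun t => hbound q t t.2
  obtain ⟨K', hK', hDK'⟩ := hT.exists_isCompact_duhamel hTc hab hν
  obtain ⟨q, hq⟩ := exists_fixedPoint_of_range_subset_isCompact (fun q => L (N q) + D q)
    ((hL.comp hN).add hD) ((hK.image hL).add hK')
    fun q => add_mem_add ⟨_, hNK q, rfl⟩ (hDK' _ (g q) (hg q) (hgν q) fun _ => rfl)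
  have hqt : ∀ t : Icc a b, q t = T (t - a) (N q) + duhamel T a (g q) t := fun t =>
    (congrArg (fun p : C(Icc a b, E) => p t) hq).symm
  have hgq : ∀ t (ht : t ∈ Icc a b), ‖q ⟨t, ht⟩‖ ≤ r → g q t = f t (q ⟨t, ht⟩) := by
    intro t ht hle
    simp only [g]
    rw [projIcc_of_mem hab ht, radialRetraction_of_norm_le hr hle]
  have hlt := hT.norm_add_duhamel_lt (b := b) (hg q) (hNr q) fun t ht hnorm _ => by
    have ht' := Ioc_subset_Icc_self ht
    rw [← hqt ⟨t, ht'⟩] at hnorm ⊢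
    rw [hgq t ht' hnorm.le]
    exact hout t ht _ hnorm
  have hle : ∀ t, ‖q t‖ ≤ r := fun t => by
    rw [hqt]
    exact (hlt t t.2).le
  refine ⟨q, hle, fun t => ?_⟩
  rw [hqt t]
  congr 2
  funext s
  simp only [g]
  rw [radialRetraction_of_norm_le hr (hle _)]

end IsContractionSemigroup

end Approximation

section Nonlocal

variable {E : Type*} [NormedAddCommGroup E] [NormedSpace ℝ E] [CompleteSpace E]

/-- Solvability of the nonlocal problem for an extended contraction semigroup and an inhomogeneity
that is continuous on all of `ℝ × E`. -/
lemma IsContractionSemigroup.exists_nonlocal_solution {T : ℝ → E →L[ℝ] E}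
    (hT : IsContractionSemigroup T) {a b r : ℝ} {ν : ℝ → ℝ}
    (hrefl : Function.Surjective (NormedSpace.inclusionInDoubleDual ℝ E))
    (hTc : ∀ t, 0 < t → IsCompactOperator (T t))
    (hab : a ≤ b) (hν : IntegrableOn ν (Icc a b)) {f : ℝ → E → E}
    (hf : Continuous fun p : ℝ × E => f p.1 p.2) (hr : 0 < r)
    (hfν : ∀ᵐ s ∂volume.restrict (Icc a b), ∀ x, ‖x‖ ≤ r → ‖f s x‖ ≤ ν s)
    (hout : ∀ t ∈ Ioc a b, ∀ x, ‖x‖ = r →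
      ∃ c > 0, ∃ᶠ h in 𝓝[>] (0:ℝ), r + c * h ≤ ‖x - h • f t x‖)
    {M : C(Icc a b, E) → E} (hM0 : ∀ y : C(Icc a b, E), (∀ t, ‖y t‖ ≤ r) → ‖M y‖ ≤ r)
    (hM1 : ∀ (y : ℕ → C(Icc a b, E)) (z : C(Icc a b, E)), (∀ n t, ‖y n t‖ ≤ r) →
      (∀ t : Icc a b, a < (t : ℝ) → Tendsto (fun n => y n t) atTop (𝓝 (z t))) →
      Tendsto (fun n => M (y n)) atTop (𝓝 (M z))) :
    ∃ q : C(Icc a b, E), (∀ t, ‖q t‖ ≤ r) ∧ ∀ t : Icc a b,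
      q t = T (t - a) (M q) + duhamel T a (fun s => f s (q (projIcc a b hab s))) t := by
  let ρ : C(Icc a b, E) → C(Icc a b, E) := fun q =>
    ⟨fun t => radialRetraction r (q t), (continuous_radialRetraction hr).comp q.continuous⟩
  have hρ : ∀ q t, ‖ρ q t‖ ≤ r := fun q t => norm_radialRetraction_le hr _
  have hMρ : Continuous fun q => M (ρ q) := by
    refine continuous_iff_seqContinuous.2 fun y z hyz => ?_
    refine hM1 (fun n => ρ (y n)) (ρ z) (fun n => hρ _) fun t _ => ?_
    exact ((continuous_radialRetraction hr).tendsto _).comp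
      (((continuous_eval_const t).tendsto z).comp hyz)
  let ε : ℕ → ℝ := fun n => 1 / ((n:ℝ) + 1)
  have hε : ∀ n, 0 < ε n := fun n => Nat.one_div_pos_of_nat
  have hε0 : Tendsto ε atTop (𝓝 0) := tendsto_one_div_add_atTop_nhds_zero_nat
  let c : ℕ → ℝ := fun n => (1 + ε n)⁻¹
  have hc : ∀ n, 0 < c n := fun n => inv_pos.2 (by linarith [hε n])
  have hc1 : ∀ n, c n < 1 := fun n => inv_lt_one_of_one_lt₀ (by linarith [hε n])
  have hclim : Tendsto c atTop (𝓝 1) := by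
    simpa using (hε0.const_add 1).inv₀ (by norm_num)
  let N : ℕ → C(Icc a b, E) → E := fun n q => T (ε n) (c n • M (ρ q))
  have hcM : ∀ n q, ‖c n • M (ρ q)‖ < r := fun n q => by
    rw [norm_smul, Real.norm_eq_abs, abs_of_pos (hc n)]
    calc c n * ‖M (ρ q)‖ ≤ c n * r :=
          mul_le_mul_of_nonneg_left (hM0 _ (hρ q)) (hc n).le
      _ < 1 * r := mul_lt_mul_of_pos_right (hc1 n) hr
      _ = r := one_mul r
  have hNr : ∀ n q, ‖N n q‖ < r := fun n q => (hT.norm_apply_le _ _).trans_lt (hcM n q)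
  choose q hqr hq using fun n => hT.exists_nonlocal_solution_of_compact hTc hab hν hf hr hfν hout
    (N := N n) ((T (ε n)).continuous.comp (hMρ.const_smul (c n)))
    ((hTc _ (hε n)).isCompact_closure_image_closedBall r)
    (fun q => subset_closure ⟨_, by simpa using (hcM n q).le, rfl⟩) (hNr n)
  have hρq : ∀ n, ρ (q n) = q n := fun n =>
    ContinuousMap.ext fun t => radialRetraction_of_norm_le hr (hqr n t)
  let G : C(Icc a b, E) → ℝ → E := fun p s => f s (p (projIcc a b hab s))
  have hG : ∀ p, Continuous (G p) := fun p =>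
    hf.comp (f := fun s => (s, p (projIcc a b hab s)))
      (continuous_id.prodMk (p.continuous.comp continuous_projIcc))
  have hGν : ∀ n, ∀ᵐ s ∂volume.restrict (Icc a b), ‖G (q n) s‖ ≤ ν s := fun n => by
    filter_upwards [hfν] with s hs using hs _ (hqr n _)
  let D : C(Icc a b, E) → C(Icc a b, E) := fun p =>
    ⟨fun t => duhamel T a (G p) t, (hT.continuous_duhamel (hG p)).comp continuous_subtype_val⟩
  obtain ⟨K, hK, hDK⟩ := hT.exists_isCompact_duhamel hTc hab hν
  obtain ⟨w, -, φ, hφ, hw⟩ := hK.tendsto_subseq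
    fun n => hDK (D (q n)) (G (q n)) (hG _) (hGν n) fun _ => rfl
  obtain ⟨x₀, hx₀, ψ, hψ, hx₀lim⟩ := hT.exists_strictMono_tendsto hrefl hTc
    (fun n => N (φ n) (q (φ n))) fun n => (hNr _ _).le
  have hw' : ∀ t, Tendsto (fun n => D (q (φ (ψ n))) t) atTop (𝓝 (w t)) := fun t =>
    ((continuous_eval_const t).tendsto w).comp (hw.comp hψ.tendsto_atTop)
  let x : C(Icc a b, E) := ⟨fun t => T (t - a) x₀ + w t, ((hT.continuous_apply x₀).comp
    (continuous_subtype_val.sub continuous_const)).add w.continuous⟩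
  have hxlim : ∀ t : Icc a b, a < (t:ℝ) →
      Tendsto (fun n => q (φ (ψ n)) t) atTop (𝓝 (x t)) := fun t ht => by
    refine ((hx₀lim _ (sub_pos.2 ht)).add (hw' t)).congr fun n => ?_
    exact (hq _ t).symm
  have hxr : ∀ t, ‖x t‖ ≤ r := fun t => by
    rcases t.2.1.eq_or_lt with ht | ht
    · have hwt : w t = 0 := by
        refine tendsto_nhds_unique (hw' t) ?_
        simp [D, duhamel, ← ht]
      simpa [x, hwt, ← ht, hT.zero_apply] using hx₀
    · exact le_of_tendsto (hxlim t ht).norm (Eventually.of_forall fun n => hqr _ t)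
  have hwD : ∀ t : Icc a b, w t = duhamel T a (G x) t := fun t => by
    obtain ⟨e, he, hbound⟩ := hT.exists_tendsto_forall_norm_duhamel_sub_le hab hν
      (g := fun n => G (q (φ (ψ n)))) (fun n => hG _) (hG x) (fun n => hGν _) fun s hs => by
        have h1 := hxlim (projIcc a b hab s)
          (by rw [projIcc_of_mem hab (Ioc_subset_Icc_self hs)]; exact hs.1)
        exact (hf.tendsto (s, x (projIcc a b hab s))).comp (tendsto_const_nhds.prodMk_nhds h1)
    refine tendsto_nhds_unique (hw' t) (tendsto_iff_norm_sub_tendsto_zero.2 ?_)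
    exact squeeze_zero (fun n => norm_nonneg _) (fun n => hbound n t t.2) he
  have hMlim : Tendsto (fun n => N (φ (ψ n)) (q (φ (ψ n)))) atTop (𝓝 (M x)) := by
    have hφψ : Tendsto (fun n => φ (ψ n)) atTop atTop := hφ.tendsto_atTop.comp hψ.tendsto_atTop
    have h1 := (hclim.comp hφψ).smul (hM1 (fun n => q (φ (ψ n))) x (fun n => hqr _) hxlim)
    have h2 := (hT.continuous_uncurry.tendsto _).comp ((hε0.comp hφψ).prodMk_nhds h1)
    simp only [one_smul, hT.zero_apply] at h2
    refine h2.congr fun n => ?_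
    simp only [N, hρq, Function.comp_apply]
  have hTx₀ : ∀ t, 0 < t → T t x₀ = T t (M x) := fun t ht =>
    tendsto_nhds_unique (hx₀lim t ht) (((T t).continuous.tendsto _).comp hMlim)
  have hMx : x₀ = M x := by
    have h0 : ∀ v, Tendsto (fun t => T t v) (𝓝[>] 0) (𝓝 v) := fun v => by
      have := ((hT.continuous_apply v).tendsto 0).mono_left (nhdsWithin_le_nhds (s := Ioi 0))
      rwa [hT.zero_apply] at this
    refine tendsto_nhds_unique (h0 x₀) ((h0 (M x)).congr' ?_)
    filter_upwards [self_mem_nhdsWithin] with t ht using (hTx₀ t ht).symm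
  refine ⟨x, hxr, fun t => ?_⟩
  rw [← hMx]
  exact congrArg (T (t - a) x₀ + ·) (hwD t)

end Nonlocal

/-- Existence of a mild solution satisfying the nonlocal condition
`x(a) = M(x)` via a locally Lipschitz bounding function. -/
theorem nonlocal_mild_solution_exists
    {E : Type*} [NormedAddCommGroup E] [NormedSpace ℝ E] [CompleteSpace E]
    (hrefl : Function.Surjective (NormedSpace.inclusionInDoubleDual ℝ E))
    (S : ℝ → E →L[ℝ] E)
    (hS0 : S 0 = ContinuousLinearMap.id ℝ E)
    (hSadd : ∀ t s : ℝ, 0 ≤ t → 0 ≤ s → S (t + s) = (S t).comp (S s))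
    (hScont : ∀ v : E, ContinuousOn (fun t => S t v) (Set.Ici (0:ℝ)))
    (hScontr : ∀ t : ℝ, 0 ≤ t → ‖S t‖ ≤ 1)
    (hScpt : ∀ t : ℝ, 0 < t → IsCompactOperator (S t))
    (a b : ℝ) (hab : a < b)
    (f : ℝ → E → E)
    (hf : ContinuousOn (fun q : ℝ × E => f q.1 q.2) (Set.Icc a b ×ˢ (Set.univ : Set E)))
    (hfbd : ∀ Ω : Set E, Bornology.IsBounded Ω →
      ∃ ν : ℝ → ℝ, IntegrableOn ν (Set.Icc a b) ∧
        ∀ᵐ t ∂(volume.restrict (Set.Icc a b)), ∀ x ∈ Ω, ‖f t x‖ ≤ ν t)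
    (r : ℝ) (hr : 0 < r)
    (M : C(Set.Icc a b, E) → E)
    (hM0 : ∀ y : C(Set.Icc a b, E), (∀ t, ‖y t‖ ≤ r) → ‖M y‖ ≤ r)
    (hM1 : ∀ (y : ℕ → C(Set.Icc a b, E)) (z : C(Set.Icc a b, E)),
      (∀ n t, ‖y n t‖ ≤ r) →
      (∀ t : Set.Icc a b, a < (t : ℝ) →
        Tendsto (fun n => y n t) atTop (nhds (z t))) →
      Tendsto (fun n => M (y n)) atTop (nhds (M z)))
    (V : E → ℝ) (hVlip : LocallyLipschitz V)
    (hV0 : ∀ x : E, ‖x‖ = r → V x = 0)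
    (hVle : ∀ x : E, ‖x‖ < r → V x ≤ 0)
    (hVb : ∀ t ∈ Set.Ioc a b, ∀ x : E, ‖x‖ = r →
      liminf (fun h : ℝ => V (x + h • f t x) / h) (nhdsWithin 0 (Set.Iio 0)) < 0) :
    ∃ (x : ℝ → E) (hx : ContinuousOn x (Set.Icc a b)),
      (∀ t ∈ Set.Icc a b, ‖x t‖ ≤ r) ∧
      (∀ t ∈ Set.Icc a b,
        x t = S (t - a) (x a) + ∫ s in a..t, S (t - s) (f s (x s))) ∧
      x a = M ⟨(Set.Icc a b).restrict x, hx.restrict⟩ := by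
  let T : ℝ → E →L[ℝ] E := fun t => S (max t 0)
  have hTS : ∀ t, 0 ≤ t → T t = S t := fun t ht => by simp only [T, max_eq_left ht]
  have hT : IsContractionSemigroup T :=
    { zero_apply := fun v => by rw [hTS 0 le_rfl, hS0]; rfl
      add_apply := fun s t hs ht v => by
        rw [hTS _ (add_nonneg hs ht), hTS s hs, hTS t ht, hSadd s t hs ht]; rfl
      continuous_apply := fun v => (hScont v).comp_continuous
        (continuous_id.max continuous_const) fun t => le_max_right t 0
      norm_apply_le := fun t v => by
        simpa using (S (max t 0)).le_of_opNorm_le (hScontr _ (le_max_right t 0)) v }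
  obtain ⟨ν, hν, hfν⟩ := hfbd (Metric.closedBall 0 r) Metric.isBounded_closedBall
  obtain ⟨q, hqr, hq⟩ := hT.exists_nonlocal_solution (f := fun t => f (projIcc a b hab.le t))
    hrefl (fun t ht => by rw [hTS t ht.le]; exact hScpt t ht) hab.le hν
    (hf.comp_continuous (f := fun p : ℝ × E => ((projIcc a b hab.le p.1 : ℝ), p.2))
      ((continuous_subtype_val.comp (continuous_projIcc.comp continuous_fst)).prodMk
        continuous_snd) fun p => ⟨(projIcc a b hab.le p.1).2, mem_univ _⟩)
    hr (by
      filter_upwards [hfν, ae_restrict_mem measurableSet_Icc] with s hs hsab x hx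
      rw [projIcc_of_mem hab.le hsab]
      exact hs x (by simpa using hx))
    (fun t ht x hx => by
      rw [projIcc_of_mem hab.le (Ioc_subset_Icc_self ht)]
      exact exists_frequently_le_norm_sub_smul_of_liminf_neg hVlip hr hV0 hVle hx (hVb t ht x hx))
    hM0 hM1
  have hx : Continuous fun t => q (projIcc a b hab.le t) := q.continuous.comp continuous_projIcc
  have hMq : M ⟨(Icc a b).domRestrict fun t => q (projIcc a b hab.le t), hx.continuousOn.domRestrict⟩
      = M q := congrArg M (ContinuousMap.ext fun t =>
      congrArg q (projIcc_val hab.le t))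
  have ha : q (projIcc a b hab.le a) = M q := by
    rw [projIcc_left, hq]
    simp [duhamel, hT.zero_apply]
  refine ⟨fun t => q (projIcc a b hab.le t), hx.continuousOn, fun t _ => hqr _, fun t ht => ?_,
    ha.trans hMq.symm⟩
  simp only
  rw [ha, projIcc_of_mem hab.le ht, hq, hTS _ (sub_nonneg.2 ht.1)]
  congr 1
  refine intervalIntegral.integral_congr fun s hs => ?_
  rw [uIcc_of_le ht.1] at hs
  simp only
  rw [hTS _ (sub_nonneg.2 hs.2), projIcc_of_mem hab.le ⟨hs.1, hs.2.trans ht.2⟩]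
end

section
/- Let E be a real Banach space, {S(t)}_{t≥0} a contraction C₀-semigroup on E, a < b, f : [a,b] × E → E continuous, and let x : [a,b] → E be a mild solution of x′ = Ax + f(t,x), i.e. x is continuous and x(t) = S(t−a)x(a) + ∫ₐᵗ S(t−s) f(s,x(s)) ds for all t ∈ [a,b]. Then for every t̂ ∈ (a,b], the one-sided limit lim_{h→0⁻} ( S(−h) x(t̂ + h) − x(t̂) ) / h exists and equals f(t̂, x(t̂)) (here h < 0, so −h > 0 and t̂ + h ∈ [a, t̂)). -/
open MeasureTheory Filter Topology Set

/-- A uniformly bounded, strongly continuous family of operators applied to a continuous family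
of vectors is continuous. -/
theorem ContinuousOn.clm_apply_of_norm_le_one {α E : Type*} [TopologicalSpace α]
    [NormedAddCommGroup E] [NormedSpace ℝ E] {S : α → E →L[ℝ] E} {g : α → E} {s : Set α}
    (hS : ∀ i ∈ s, ‖S i‖ ≤ 1) (hScont : ∀ v : E, ContinuousOn (fun i => S i v) s)
    (hg : ContinuousOn g s) : ContinuousOn (fun i => S i (g i)) s := by
  intro i hi
  have hdiff : Tendsto (fun j => S j (g j - g i)) (𝓝[s] i) (𝓝 0) := by
    have hnorm : Tendsto (fun j => ‖g j - g i‖) (𝓝[s] i) (𝓝 0) :=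
      tendsto_iff_norm_sub_tendsto_zero.1 (hg i hi)
    refine squeeze_zero_norm' ?_ hnorm
    filter_upwards [self_mem_nhdsWithin] with j hj
    exact (S j).le_of_opNorm_le (hS j hj) _ |>.trans_eq (one_mul _)
  have hsum := hdiff.add (hScont (g i) i hi)
  simpa [ContinuousWithinAt] using hsum

/-- The left derivative of the primitive of a function continuous on `[a, T]`. -/
theorem ContinuousOn.hasDerivWithinAt_integral_Iic {E : Type*} [NormedAddCommGroup E]
    [NormedSpace ℝ E] [CompleteSpace E] {F : ℝ → E} {a T : ℝ} (haT : a < T)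
    (hF : ContinuousOn F (Set.Icc a T)) :
    HasDerivWithinAt (fun u => ∫ s in a..u, F s) (F T) (Set.Iic T) T := by
  have hnhds : 𝓝[Set.Icc a T] T = 𝓝[≤] T := nhdsWithin_Icc_eq_nhdsLE haT
  refine intervalIntegral.integral_hasDerivWithinAt_right (t := Set.Iic T)
    (hF.intervalIntegrable_of_Icc haT.le) ?_ ?_
  · exact hnhds ▸ hF.stronglyMeasurableAtFilter_nhdsWithin measurableSet_Icc T
  · have hcont := hF T (right_mem_Icc.2 haT.le)
    rwa [ContinuousWithinAt, hnhds] at hcont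

/-- For a mild solution `x` and `t̂ ∈ (a,b]`, the one-sided limit
`lim_{h→0⁻} (S(−h)x(t̂+h) − x(t̂))/h` exists and equals `f(t̂, x(t̂))`. -/
theorem mild_solution_left_derivative
    {E : Type*} [NormedAddCommGroup E] [NormedSpace ℝ E] [CompleteSpace E]
    (S : ℝ → E →L[ℝ] E)
    (hS0 : S 0 = ContinuousLinearMap.id ℝ E)
    (hSadd : ∀ t s : ℝ, 0 ≤ t → 0 ≤ s → S (t + s) = (S t).comp (S s))
    (hScont : ∀ v : E, ContinuousOn (fun t => S t v) (Set.Ici (0:ℝ)))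
    (hScontr : ∀ t : ℝ, 0 ≤ t → ‖S t‖ ≤ 1)
    (a b : ℝ) (hab : a < b)
    (f : ℝ → E → E)
    (hf : ContinuousOn (fun q : ℝ × E => f q.1 q.2) (Set.Icc a b ×ˢ (Set.univ : Set E)))
    (x : ℝ → E) (hx : ContinuousOn x (Set.Icc a b))
    (hmild : ∀ t ∈ Set.Icc a b,
      x t = S (t - a) (x a) + ∫ s in a..t, S (t - s) (f s (x s))) :
    ∀ that ∈ Set.Ioc a b,
      Tendsto (fun h : ℝ => h⁻¹ • (S (-h) (x (that + h)) - x that))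
        (nhdsWithin 0 (Set.Iio 0)) (nhds (f that (x that))) := by
  rintro T ⟨haT, hTb⟩
  have hg : ContinuousOn (fun s => f s (x s)) (Set.Icc a b) :=
    hf.comp (continuousOn_id.prodMk hx) fun s hs => ⟨hs, mem_univ _⟩
  have hF : ∀ t ∈ Set.Icc a b,
      ContinuousOn (fun s => S (t - s) (f s (x s))) (Set.Icc a t) := fun t ht =>
    ContinuousOn.clm_apply_of_norm_le_one
      (fun s hs => hScontr _ (sub_nonneg.2 hs.2))
      (fun v => (hScont v).comp (continuousOn_const.sub continuousOn_id)
        fun s hs => sub_nonneg.2 hs.2)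
      (hg.mono (Icc_subset_Icc_right ht.2))
  have hFT := hF T ⟨haT.le, hTb⟩
  -- The semigroup law moves `S (T - t)` under the integral in the mild formula for `x t`.
  have hpush : ∀ t ∈ Set.Icc a T,
      S (T - t) (x t) = S (T - a) (x a) + ∫ s in a..t, S (T - s) (f s (x s)) := by
    intro t ht
    have htb : t ∈ Set.Icc a b := ⟨ht.1, ht.2.trans hTb⟩
    have hcomp : ∀ s ≤ t, ∀ v, S (T - t) (S (t - s) v) = S (T - s) v := by
      intro s hs v
      rw [← ContinuousLinearMap.comp_apply,
        ← hSadd _ _ (sub_nonneg.2 ht.2) (sub_nonneg.2 hs), sub_add_sub_cancel]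
    rw [hmild t htb, map_add, hcomp a ht.1,
      ← ContinuousLinearMap.intervalIntegral_comp_comm _
        ((hF t htb).intervalIntegrable_of_Icc ht.1)]
    congr 1
    refine intervalIntegral.integral_congr fun s hs => ?_
    rw [uIcc_of_le ht.1] at hs
    exact hcomp s hs.2 _
  have hderiv := (hFT.hasDerivWithinAt_integral_Iic haT).mono Iio_subset_Iic_self
  rw [hasDerivWithinAt_iff_tendsto_slope' (by simp)] at hderiv
  simp only [sub_self, hS0, ContinuousLinearMap.id_apply] at hderiv
  have hshift : Tendsto (fun h : ℝ => T + h) (𝓝[<] 0) (𝓝[<] T) := by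
    refine tendsto_nhdsWithin_iff.2 ⟨?_, ?_⟩
    · have hcont : Tendsto (fun h : ℝ => T + h) (𝓝 0) (𝓝 (T + 0)) :=
        (continuous_const.add continuous_id).tendsto 0
      rw [add_zero] at hcont
      exact hcont.mono_left nhdsWithin_le_nhds
    · filter_upwards [self_mem_nhdsWithin] with h hh
      exact add_lt_of_neg_right T hh
  refine (hderiv.comp hshift).congr' ?_
  filter_upwards [Ioo_mem_nhdsLT (sub_neg.2 haT)] with h hh
  have hleft := hpush (T + h) ⟨by linarith [hh.1], by linarith [hh.2]⟩
  rw [sub_add_cancel_left] at hleft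
  rw [hleft, hmild T ⟨haT.le, hTb⟩, add_sub_add_left_eq_sub]
  simp [slope_def_module]
end
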